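/- (Proposition: energy decay for smooth solutions.) Assume (A.1), (A.2), (V.1), (V.2), let C* > 0 be a constant for which the Poincaré-type inequality ∫_{|x|≤L} w² ≤ C*(∫_ℝ (w')² + ∫_{|x|≥L} w²) holds on H¹(ℝ), and suppose 0 < V(0) < 1/(4C*). Then there exists C > 0 such that for every smooth classical solution u of u_tt − u_xx + V(x)u + a(x)u_t = 0 with smooth compactly supported initial data (u₀,u₁) and all t ≥ 0: ∫₀ᵗ E_u(s) ds ≤ C ( ‖u₀‖²_{H¹} + ‖u₁‖²_{L²} + ∫_ℝ |u₁(x) + a(x)u₀(x)|²/V(x) dx ) and (1+t) E_u(t) ≤ C ( ‖u₀‖²_{H¹} + ‖u₁‖²_{L²} + ∫_ℝ |u₁(x) + a(x)u₀(x)|²/V(x) dx ). -/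

import Mathlib

open MeasureTheory

noncomputable def ut (u : ℝ → ℝ → ℝ) (t x : ℝ) : ℝ := deriv (fun s => u s x) t

noncomputable def ux (u : ℝ → ℝ → ℝ) (t x : ℝ) : ℝ := deriv (fun y => u t y) x

noncomputable def utt (u : ℝ → ℝ → ℝ) (t x : ℝ) : ℝ := deriv (fun s => ut u s x) t

noncomputable def uxx (u : ℝ → ℝ → ℝ) (t x : ℝ) : ℝ := deriv (fun y => ux u t y) x

noncomputable def Eu (V : ℝ → ℝ) (u : ℝ → ℝ → ℝ) (t : ℝ) : ℝ :=
  (1/2) * ((∫ x, (ut u t x)^2) + (∫ x, (ux u t x)^2) + ∫ x, V x * (u t x)^2)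

/-- `u` is a smooth classical solution of `u_tt - u_xx + V u + a u_t = 0` with smooth
compactly supported initial data `(u₀, u₁)`, vanishing for large `|x|` on each `[0,T]`. -/
def IsSmoothSolution (V a : ℝ → ℝ) (u : ℝ → ℝ → ℝ) (u₀ u₁ : ℝ → ℝ) : Prop :=
  ContDiff ℝ (⊤ : ℕ∞) (fun p : ℝ × ℝ => u p.1 p.2) ∧
  (∀ t > (0:ℝ), ∀ x : ℝ, utt u t x - uxx u t x + V x * u t x + a x * ut u t x = 0) ∧
  (∀ x : ℝ, u 0 x = u₀ x) ∧ (∀ x : ℝ, ut u 0 x = u₁ x) ∧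
  ContDiff ℝ (⊤ : ℕ∞) u₀ ∧ HasCompactSupport u₀ ∧
  ContDiff ℝ (⊤ : ℕ∞) u₁ ∧ HasCompactSupport u₁ ∧
  (∀ T > (0:ℝ), ∃ R > (0:ℝ), ∀ t ∈ Set.Icc (0:ℝ) T, ∀ x : ℝ, R ≤ |x| → u t x = 0)


/-- joint smoothness -/
def Sm (u : ℝ → ℝ → ℝ) : Prop := ContDiff ℝ (⊤ : ℕ∞) (fun p : ℝ × ℝ => u p.1 p.2)

lemma Sm.hasFDerivAt {u : ℝ → ℝ → ℝ} (h : Sm u) (p : ℝ × ℝ) :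
    HasFDerivAt (fun p : ℝ × ℝ => u p.1 p.2) (fderiv ℝ (fun p : ℝ × ℝ => u p.1 p.2) p) p :=
  ((ContDiff.differentiable h (by simp)) p).hasFDerivAt

lemma Sm.aux_t {u : ℝ → ℝ → ℝ} (h : Sm u) (t x : ℝ) :
    HasDerivAt (fun s => u s x) (fderiv ℝ (fun p : ℝ × ℝ => u p.1 p.2) (t, x) (1, 0)) t := by
  have h1 : HasDerivAt (fun s : ℝ => (s, x)) ((1:ℝ), (0:ℝ)) t :=
    (hasDerivAt_id t).prodMk (hasDerivAt_const t x)
  exact (h.hasFDerivAt (t, x)).comp_hasDerivAt t h1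

lemma Sm.aux_x {u : ℝ → ℝ → ℝ} (h : Sm u) (t x : ℝ) :
    HasDerivAt (fun y => u t y) (fderiv ℝ (fun p : ℝ × ℝ => u p.1 p.2) (t, x) (0, 1)) x := by
  have h1 : HasDerivAt (fun y : ℝ => (t, y)) ((0:ℝ), (1:ℝ)) x :=
    (hasDerivAt_const x t).prodMk (hasDerivAt_id x)
  exact (h.hasFDerivAt (t, x)).comp_hasDerivAt x h1

lemma Sm.ut_eq {u : ℝ → ℝ → ℝ} (h : Sm u) (t x : ℝ) :
    ut u t x = fderiv ℝ (fun p : ℝ × ℝ => u p.1 p.2) (t, x) (1, 0) := (h.aux_t t x).deriv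

lemma Sm.ux_eq {u : ℝ → ℝ → ℝ} (h : Sm u) (t x : ℝ) :
    ux u t x = fderiv ℝ (fun p : ℝ × ℝ => u p.1 p.2) (t, x) (0, 1) := (h.aux_x t x).deriv

lemma Sm.hasDerivAt_t {u : ℝ → ℝ → ℝ} (h : Sm u) (t x : ℝ) :
    HasDerivAt (fun s => u s x) (ut u t x) t := by
  rw [h.ut_eq]; exact h.aux_t t x

lemma Sm.hasDerivAt_x {u : ℝ → ℝ → ℝ} (h : Sm u) (t x : ℝ) :
    HasDerivAt (fun y => u t y) (ux u t x) x := by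
  rw [h.ux_eq]; exact h.aux_x t x

lemma Sm.smooth_fderiv {u : ℝ → ℝ → ℝ} (h : Sm u) (v : ℝ × ℝ) :
    ContDiff ℝ (⊤ : ℕ∞) (fun p => fderiv ℝ (fun p : ℝ × ℝ => u p.1 p.2) p v) :=
  (ContDiff.fderiv_right (m := (⊤ : ℕ∞)) h (by simp)).clm_apply contDiff_const

lemma Sm.ut {u : ℝ → ℝ → ℝ} (h : Sm u) : Sm (ut u) := by
  have := h.smooth_fderiv (1, 0)
  unfold Sm
  convert this using 2 with p
  exact h.ut_eq p.1 p.2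

lemma Sm.ux {u : ℝ → ℝ → ℝ} (h : Sm u) : Sm (ux u) := by
  have := h.smooth_fderiv (0, 1)
  unfold Sm
  convert this using 2 with p
  exact h.ux_eq p.1 p.2

lemma Sm.comm {u : ℝ → ℝ → ℝ} (h : Sm u) (t x : ℝ) : _root_.ut (_root_.ux u) t x = _root_.ux (_root_.ut u) t x := by
  rw [h.ux.ut_eq, h.ut.ux_eq]
  have e1 : (fun p : ℝ × ℝ => _root_.ux u p.1 p.2) =
      fun p => fderiv ℝ (fun p : ℝ × ℝ => u p.1 p.2) p (0, 1) := by
    ext p; exact h.ux_eq p.1 p.2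
  have e2 : (fun p : ℝ × ℝ => _root_.ut u p.1 p.2) =
      fun p => fderiv ℝ (fun p : ℝ × ℝ => u p.1 p.2) p (1, 0) := by
    ext p; exact h.ut_eq p.1 p.2
  have hd : DifferentiableAt ℝ (fderiv ℝ (fun p : ℝ × ℝ => u p.1 p.2)) (t, x) :=
    (ContDiff.fderiv_right (m := (⊤ : ℕ∞)) h (by simp)).differentiable (by simp) _
  rw [e1, e2, fderiv_clm_apply hd (by fun_prop), fderiv_clm_apply hd (by fun_prop)]
  have hs : IsSymmSndFDerivAt ℝ (fun p : ℝ × ℝ => u p.1 p.2) (t, x) :=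
    ContDiffAt.isSymmSndFDerivAt (n := (⊤ : ℕ∞)) (ContDiff.contDiffAt h)
      (by simp only [minSmoothness_of_isRCLikeNormedField]; exact WithTop.coe_le_coe.2 (le_top : (2 : ℕ∞) ≤ ⊤))
  simp
  exact hs.eq (1, 0) (0, 1)

lemma Sm.continuous {u : ℝ → ℝ → ℝ} (h : Sm u) : Continuous (fun p : ℝ × ℝ => u p.1 p.2) :=
  ContDiff.continuous h

lemma swap_cont {f : ℝ → ℝ → ℝ} (hf : Continuous (fun p : ℝ × ℝ => f p.1 p.2)) (a b c d : ℝ) :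
    ∫ t in a..b, ∫ x in c..d, f t x = ∫ x in c..d, ∫ t in a..b, f t x := by
  apply intervalIntegral_intervalIntegral_swap
  have : IntegrableOn (Function.uncurry f) (Set.uIcc a b ×ˢ Set.uIcc c d) :=
    ContinuousOn.integrableOn_compact (isCompact_uIcc.prod isCompact_uIcc) hf.continuousOn
  exact this.mono_set (Set.prod_mono Set.uIoc_subset_uIcc Set.uIoc_subset_uIcc)

lemma cont_slice_x {f : ℝ → ℝ → ℝ} (hf : Continuous (fun p : ℝ × ℝ => f p.1 p.2)) (t : ℝ) :
    Continuous (fun x => f t x) := hf.comp (by fun_prop : Continuous fun x : ℝ => (t, x))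

lemma cont_slice_t {f : ℝ → ℝ → ℝ} (hf : Continuous (fun p : ℝ × ℝ => f p.1 p.2)) (x : ℝ) :
    Continuous (fun t => f t x) := hf.comp (by fun_prop : Continuous fun t : ℝ => (t, x))

lemma cont_int {f : ℝ → ℝ → ℝ} (hf : Continuous (fun p : ℝ × ℝ => f p.1 p.2)) (c d : ℝ) :
    Continuous (fun t => ∫ x in c..d, f t x) :=
  intervalIntegral.continuous_parametric_intervalIntegral_of_continuous' (f := f) hf c d

lemma div_id {F Ft G Gx : ℝ → ℝ → ℝ} {T R : ℝ} (hT : 0 ≤ T)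
    (hF : ∀ t x, HasDerivAt (fun s => F s x) (Ft t x) t)
    (hG : ∀ t x, HasDerivAt (fun y => G t y) (Gx t x) x)
    (cFt : Continuous (fun p : ℝ × ℝ => Ft p.1 p.2))
    (cGx : Continuous (fun p : ℝ × ℝ => Gx p.1 p.2))
    (cF : ∀ t, Continuous (fun x => F t x))
    (bG : ∀ t ∈ Set.Icc 0 T, G t R = 0 ∧ G t (-R) = 0) :
    (∫ x in (-R)..R, F T x) - (∫ x in (-R)..R, F 0 x)
      = ∫ t in (0:ℝ)..T, ∫ x in (-R)..R, (Ft t x + Gx t x) := by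
  have h1 : ∫ t in (0:ℝ)..T, ∫ x in (-R)..R, (Ft t x + Gx t x)
      = ∫ t in (0:ℝ)..T, ∫ x in (-R)..R, Ft t x := by
    apply intervalIntegral.integral_congr
    intro t ht
    rw [Set.uIcc_of_le hT] at ht
    dsimp only
    rw [intervalIntegral.integral_add ((cont_slice_x cFt t).intervalIntegrable _ _)
      ((cont_slice_x cGx t).intervalIntegrable _ _),
      intervalIntegral.integral_eq_sub_of_hasDerivAt (fun x _ => hG t x)
      ((cont_slice_x cGx t).intervalIntegrable _ _), (bG t ht).1, (bG t ht).2]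
    ring
  rw [h1, swap_cont cFt, ← intervalIntegral.integral_sub ((cF T).intervalIntegrable _ _)
    ((cF 0).intervalIntegrable _ _)]
  apply intervalIntegral.integral_congr
  intro x _
  dsimp only
  rw [intervalIntegral.integral_eq_sub_of_hasDerivAt (fun t _ => hF t x)
      ((cont_slice_t cFt x).intervalIntegrable _ _)]

lemma hasDerivAt_param {f fx : ℝ → ℝ → ℝ} (hf : ∀ t x, HasDerivAt (fun y => f t y) (fx t x) x)
    (cf : Continuous (fun p : ℝ × ℝ => f p.1 p.2))
    (cfx : Continuous (fun p : ℝ × ℝ => fx p.1 p.2)) (T x : ℝ) :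
    HasDerivAt (fun y => ∫ t in (0:ℝ)..T, f t y) (∫ t in (0:ℝ)..T, fx t x) x := by
  have c2 : Continuous (fun y => ∫ t in (0:ℝ)..T, fx t y) :=
    cont_int (f := fun y t => fx t y) (cfx.comp continuous_swap) 0 T
  have e : (fun y => ∫ t in (0:ℝ)..T, f t y) =
      fun y => (∫ t in (0:ℝ)..T, f t 0) + ∫ z in (0:ℝ)..y, ∫ t in (0:ℝ)..T, fx t z := by
    ext y
    rw [← swap_cont cfx, ← intervalIntegral.integral_add
      ((cont_slice_t cf 0).intervalIntegrable _ _)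
      ((cont_int cfx 0 y).intervalIntegrable _ _)]
    apply intervalIntegral.integral_congr
    intro t _
    dsimp only
    rw [intervalIntegral.integral_eq_sub_of_hasDerivAt (fun z _ => hf t z)
      ((cont_slice_x cfx t).intervalIntegrable _ _)]
    ring
  rw [e]
  exact (intervalIntegral.integral_hasDerivAt_right (c2.intervalIntegrable _ _)
    c2.stronglyMeasurable.stronglyMeasurableAtFilter c2.continuousAt).const_add _

lemma cont_prim {f : ℝ → ℝ → ℝ} (hf : Continuous (fun p : ℝ × ℝ => f p.1 p.2)) :
    Continuous (fun p : ℝ × ℝ => ∫ s in (0:ℝ)..p.1, f s p.2) :=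
  intervalIntegral.continuous_parametric_intervalIntegral_of_continuous
    (f := fun (p : ℝ × ℝ) s => f s p.2)
    (hf.comp (by fun_prop : Continuous fun q : (ℝ × ℝ) × ℝ => (q.2, q.1.2))) continuous_fst

lemma hasDerivAt_prim {f : ℝ → ℝ → ℝ} (hf : Continuous (fun p : ℝ × ℝ => f p.1 p.2)) (t x : ℝ) :
    HasDerivAt (fun s => ∫ r in (0:ℝ)..s, f r x) (f t x) t := by
  have c2 := cont_slice_t hf x
  exact intervalIntegral.integral_hasDerivAt_right (c2.intervalIntegrable _ _)
    c2.stronglyMeasurable.stronglyMeasurableAtFilter c2.continuousAt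

lemma int_conv {f : ℝ → ℝ} {R : ℝ} (h : ∀ x, R ≤ |x| → f x = 0) :
    ∫ x, f x = ∫ x in (-R)..R, f x := by
  symm
  apply intervalIntegral.integral_eq_integral_of_support_subset
  intro x hx
  have : |x| < R := by
    by_contra h'
    exact hx (h x (not_lt.1 h'))
  rw [abs_lt] at this
  exact ⟨this.1, this.2.le⟩

lemma integrable_of_vanish {f : ℝ → ℝ} {R : ℝ} (hf : Continuous f)
    (h : ∀ x, R ≤ |x| → f x = 0) : Integrable f := by
  apply hf.integrable_of_hasCompactSupport
  apply HasCompactSupport.intro (K := Set.Icc (-R) R) isCompact_Icc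
  intro x hx
  apply h
  by_contra h'
  rw [not_le, abs_lt] at h'
  exact hx ⟨h'.1.le, h'.2.le⟩

lemma div_le {F Ft G Gx H : ℝ → ℝ → ℝ} {T R : ℝ} (hT : 0 ≤ T)
    (hF : ∀ t x, HasDerivAt (fun s => F s x) (Ft t x) t)
    (hG : ∀ t x, HasDerivAt (fun y => G t y) (Gx t x) x)
    (cFt : Continuous (fun p : ℝ × ℝ => Ft p.1 p.2))
    (cGx : Continuous (fun p : ℝ × ℝ => Gx p.1 p.2))
    (cF : ∀ t, Continuous (fun x => F t x))
    (bG : ∀ t ∈ Set.Icc 0 T, G t R = 0 ∧ G t (-R) = 0)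
    (cH : Continuous (fun p : ℝ × ℝ => H p.1 p.2))
    (hH : ∀ t ∈ Set.Ioo 0 T, ∫ x in (-R)..R, (Ft t x + Gx t x) ≤ ∫ x in (-R)..R, H t x) :
    (∫ x in (-R)..R, F T x) - (∫ x in (-R)..R, F 0 x)
      ≤ ∫ t in (0:ℝ)..T, ∫ x in (-R)..R, H t x := by
  rw [div_id hT hF hG cFt cGx cF bG]
  exact intervalIntegral.integral_mono_on_of_le_Ioo hT
    ((cont_int (f := fun t x => Ft t x + Gx t x) (cFt.add cGx) (-R) R).intervalIntegrable _ _)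
    ((cont_int cH (-R) R).intervalIntegrable _ _) hH

lemma div_le_pt {F Ft G Gx H : ℝ → ℝ → ℝ} {T R : ℝ} (hT : 0 ≤ T) (hR : 0 ≤ R)
    (hF : ∀ t x, HasDerivAt (fun s => F s x) (Ft t x) t)
    (hG : ∀ t x, HasDerivAt (fun y => G t y) (Gx t x) x)
    (cFt : Continuous (fun p : ℝ × ℝ => Ft p.1 p.2))
    (cGx : Continuous (fun p : ℝ × ℝ => Gx p.1 p.2))
    (cF : ∀ t, Continuous (fun x => F t x))
    (bG : ∀ t ∈ Set.Icc 0 T, G t R = 0 ∧ G t (-R) = 0)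
    (cH : Continuous (fun p : ℝ × ℝ => H p.1 p.2))
    (hH : ∀ t ∈ Set.Ioo 0 T, ∀ x, Ft t x + Gx t x ≤ H t x) :
    (∫ x in (-R)..R, F T x) - (∫ x in (-R)..R, F 0 x)
      ≤ ∫ t in (0:ℝ)..T, ∫ x in (-R)..R, H t x := by
  refine div_le hT hF hG cFt cGx cF bG cH fun t ht => ?_
  refine intervalIntegral.integral_mono_on (by linarith)
    ((cont_slice_x (f := fun t x => Ft t x + Gx t x) (cFt.add cGx) t).intervalIntegrable _ _)
    ((cont_slice_x cH t).intervalIntegrable _ _) fun x _ => hH t ht x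

/-- Local setting. -/
structure Loc (V a : ℝ → ℝ) (u : ℝ → ℝ → ℝ) (T R : ℝ) : Prop where
  hT : 0 ≤ T
  hR : 0 ≤ R
  sm : Sm u
  cV : Continuous V
  ca : Continuous a
  pde : ∀ t > 0, ∀ x, ut (ut u) t x - ux (ux u) t x + V x * u t x + a x * ut u t x = 0
  z : ∀ t ∈ Set.Icc 0 T, ∀ x, R ≤ |x| → u t x = 0 ∧ ut u t x = 0 ∧ ux u t x = 0

section

variable {V a : ℝ → ℝ} {u : ℝ → ℝ → ℝ} {T R : ℝ}

lemma Loc.zR (h : Loc V a u T R) {t : ℝ} (ht : t ∈ Set.Icc 0 T) :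
    u t R = 0 ∧ ut u t R = 0 ∧ ux u t R = 0 := h.z t ht R (le_abs_self R)

lemma Loc.zL (h : Loc V a u T R) {t : ℝ} (ht : t ∈ Set.Icc 0 T) :
    u t (-R) = 0 ∧ ut u t (-R) = 0 ∧ ux u t (-R) = 0 :=
  h.z t ht (-R) (by rw [abs_neg]; exact le_abs_self R)

/-- twice the energy density -/
noncomputable def ed (V : ℝ → ℝ) (u : ℝ → ℝ → ℝ) (t x : ℝ) : ℝ :=
  (ut u t x)^2 + (ux u t x)^2 + V x * (u t x)^2

lemma Loc.energy (h : Loc V a u T R) :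
    (∫ x in (-R)..R, ed V u T x) - (∫ x in (-R)..R, ed V u 0 x)
      ≤ ∫ t in (0:ℝ)..T, ∫ x in (-R)..R, -2 * (a x * (ut u t x)^2) := by
  have cV := h.cV
  have ca := h.ca
  have c0 := h.sm.continuous
  have c1 := h.sm.ut.continuous
  have c2 := h.sm.ux.continuous
  have c3 := h.sm.ut.ut.continuous
  have c4 := h.sm.ut.ux.continuous
  have c5 := h.sm.ux.ux.continuous
  refine div_le_pt (F := ed V u)
    (Ft := fun t x => 2 * ut u t x * ut (ut u) t x + 2 * ux u t x * ux (ut u) t x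
      + V x * (2 * u t x * ut u t x))
    (G := fun t x => -2 * (ut u t x * ux u t x))
    (Gx := fun t x => -2 * (ux (ut u) t x * ux u t x + ut u t x * ux (ux u) t x))
    h.hT h.hR ?_ ?_ ?_ ?_ ?_ ?_ ?_ ?_
  · intro t x
    have := (((h.sm.ut.hasDerivAt_t t x).pow 2).add ((h.sm.ux.hasDerivAt_t t x).pow 2)).add
      (((h.sm.hasDerivAt_t t x).pow 2).const_mul (V x))
    rw [h.sm.comm] at this
    refine HasDerivAt.congr_deriv (this) ?_
    push_cast; ring
  · intro t x
    exact ((h.sm.ut.hasDerivAt_x t x).mul (h.sm.ux.hasDerivAt_x t x)).const_mul (-2)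
  · fun_prop
  · fun_prop
  · intro t
    have c0 := cont_slice_x c0 t
    have c1 := cont_slice_x c1 t
    have c2 := cont_slice_x c2 t
    unfold ed
    fun_prop
  · intro t ht
    simp [(h.zR ht).2.1, (h.zL ht).2.1]
  · fun_prop
  · intro t ht x
    have := h.pde t ht.1 x
    linear_combination 2 * ut u t x * this

lemma Loc.tenergy (h : Loc V a u T R) (ha : ∀ x, 0 ≤ a x) :
    (∫ x in (-R)..R, T * ed V u T x)
      ≤ ∫ t in (0:ℝ)..T, ∫ x in (-R)..R, ed V u t x := by
  have cV := h.cV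
  have ca := h.ca
  have c0 := h.sm.continuous
  have c1 := h.sm.ut.continuous
  have c2 := h.sm.ux.continuous
  have c3 := h.sm.ut.ut.continuous
  have c4 := h.sm.ut.ux.continuous
  have c5 := h.sm.ux.ux.continuous
  have key := div_le_pt (T := T) (R := R) (F := fun t x => t * ed V u t x)
    (Ft := fun t x => ed V u t x + t * (2 * ut u t x * ut (ut u) t x + 2 * ux u t x * ux (ut u) t x
      + V x * (2 * u t x * ut u t x)))
    (G := fun t x => (-2 * t) * (ut u t x * ux u t x))
    (Gx := fun t x => (-2 * t) * (ux (ut u) t x * ux u t x + ut u t x * ux (ux u) t x))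
    (H := ed V u)
    h.hT h.hR ?_ ?_ ?_ ?_ ?_ ?_ ?_ ?_
  · simpa using key
  · intro t x
    have := (((h.sm.ut.hasDerivAt_t t x).pow 2).add ((h.sm.ux.hasDerivAt_t t x).pow 2)).add
      (((h.sm.hasDerivAt_t t x).pow 2).const_mul (V x))
    rw [h.sm.comm] at this
    refine HasDerivAt.congr_deriv ((hasDerivAt_id t).mul this) ?_
    simp [ed]
  · intro t x
    exact ((h.sm.ut.hasDerivAt_x t x).mul (h.sm.ux.hasDerivAt_x t x)).const_mul (-2 * t)
  · unfold ed; fun_prop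
  · fun_prop
  · intro t
    have c0 := cont_slice_x c0 t
    have c1 := cont_slice_x c1 t
    have c2 := cont_slice_x c2 t
    unfold ed
    fun_prop
  · intro t ht
    simp [(h.zR ht).2.1, (h.zL ht).2.1]
  · unfold ed; fun_prop
  · intro t ht x
    have := h.pde t ht.1 x
    have h2 : 0 ≤ t * (a x * (ut u t x)^2) :=
      mul_nonneg ht.1.le (mul_nonneg (ha x) (sq_nonneg _))
    linear_combination 2 * t * ut u t x * this + 2 * h2

lemma Loc.intpde (h : Loc V a u T R) {t : ℝ} (ht : 0 ≤ t) (x : ℝ) :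
    ut u t x - ut u 0 x = (∫ s in (0:ℝ)..t, ux (ux u) s x) - V x * (∫ s in (0:ℝ)..t, u s x)
      - a x * (u t x - u 0 x) := by
  have c0 := cont_slice_t h.sm.continuous x
  have c1 := cont_slice_t h.sm.ut.continuous x
  have c3 := cont_slice_t h.sm.ut.ut.continuous x
  have c5 := cont_slice_t h.sm.ux.ux.continuous x
  rw [← intervalIntegral.integral_eq_sub_of_hasDerivAt (fun s _ => h.sm.ut.hasDerivAt_t s x)
    (c3.intervalIntegrable _ _),
    ← intervalIntegral.integral_eq_sub_of_hasDerivAt (fun s _ => h.sm.hasDerivAt_t s x)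
    (c1.intervalIntegrable _ _), ← intervalIntegral.integral_const_mul,
    ← intervalIntegral.integral_const_mul, ← intervalIntegral.integral_sub
      (c5.intervalIntegrable _ _) ((c0.const_mul _).intervalIntegrable _ _),
    ← intervalIntegral.integral_sub
      (Continuous.intervalIntegrable (by fun_prop) _ _) ((c1.const_mul _).intervalIntegrable _ _)]
  rw [intervalIntegral.integral_of_le ht, intervalIntegral.integral_of_le ht]
  apply setIntegral_congr_fun measurableSet_Ioc
  intro s hs
  have := h.pde s hs.1 x
  dsimp only
  linear_combination this

lemma Loc.l2 (h : Loc V a u T R) (hVp : ∀ x, 0 < V x) :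
    (∫ x in (-R)..R, (1/2) * (u T x)^2 - (1/2) * ((ut u 0 x + a x * u 0 x)^2 / V x))
      - (∫ x in (-R)..R, (1/2) * (u 0 x)^2)
      ≤ ∫ t in (0:ℝ)..T, ∫ x in (-R)..R, - (a x * (u t x)^2) := by
  have cV := h.cV
  have ca := h.ca
  have c0 := h.sm.continuous
  have c1 := h.sm.ut.continuous
  have c2 := h.sm.ux.continuous
  have c5 := h.sm.ux.ux.continuous
  have w0 := cont_prim c0
  have w1 := cont_prim c2
  have w2 := cont_prim c5
  have g0 := cont_slice_x c0 0
  have g1 := cont_slice_x c1 0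
  have cFall : ∀ t, Continuous (fun x => (1/2) * (u t x)^2
      + (1/2) * V x * (∫ s in (0:ℝ)..t, u s x)^2
      + (1/2) * (∫ s in (0:ℝ)..t, ux u s x)^2
      - (ut u 0 x + a x * u 0 x) * (∫ s in (0:ℝ)..t, u s x)) := by
    intro t
    have := cont_slice_x c0 t
    have := cont_slice_x (f := fun t x => ∫ s in (0:ℝ)..t, u s x) w0 t
    have := cont_slice_x (f := fun t x => ∫ s in (0:ℝ)..t, ux u s x) w1 t
    fun_prop
  have key := div_le_pt (T := T) (R := R)
    (F := fun t x => (1/2) * (u t x)^2 + (1/2) * V x * (∫ s in (0:ℝ)..t, u s x)^2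
      + (1/2) * (∫ s in (0:ℝ)..t, ux u s x)^2
      - (ut u 0 x + a x * u 0 x) * (∫ s in (0:ℝ)..t, u s x))
    (Ft := fun t x => u t x * ut u t x + V x * (∫ s in (0:ℝ)..t, u s x) * u t x
      + (∫ s in (0:ℝ)..t, ux u s x) * ux u t x
      - (ut u 0 x + a x * u 0 x) * u t x)
    (G := fun t x => -((∫ s in (0:ℝ)..t, ux u s x) * u t x))
    (Gx := fun t x => -((∫ s in (0:ℝ)..t, ux (ux u) s x) * u t x
        + (∫ s in (0:ℝ)..t, ux u s x) * ux u t x))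
    (H := fun t x => - (a x * (u t x)^2))
    h.hT h.hR ?_ ?_ ?_ ?_ ?_ ?_ ?_ ?_
  · refine le_trans (sub_le_sub ?_ ?_) key
    · refine intervalIntegral.integral_mono_on (by linarith [h.hR]) ?_ ?_ ?_
      · refine Continuous.intervalIntegrable ?_ _ _
        have := cont_slice_x c0 T
        have hne : ∀ x, V x ≠ 0 := fun x => (hVp x).ne'
        fun_prop (disch := assumption)
      · exact (cFall T).intervalIntegrable _ _
      · intro x _
        have hv := hVp x
        generalize (∫ s in (0:ℝ)..T, u s x) = w
        generalize ut u 0 x + a x * u 0 x = g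
        have : 0 ≤ (V x * w - g)^2 / V x := by positivity
        have e : (V x * w - g)^2 / V x = V x * w^2 - 2 * g * w + g^2 / V x := by
          field_simp
          ring
        rw [e] at this
        nlinarith [sq_nonneg (∫ s in (0:ℝ)..T, ux u s x)]
    · simp
  · intro t x
    have d1 := ((h.sm.hasDerivAt_t t x).pow 2).const_mul (1/2 : ℝ)
    have d2 := ((hasDerivAt_prim c0 t x).pow 2).const_mul (1/2 * V x)
    have d3 := ((hasDerivAt_prim c2 t x).pow 2).const_mul (1/2 : ℝ)
    have d4 := (hasDerivAt_prim c0 t x).const_mul (ut u 0 x + a x * u 0 x)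
    refine HasDerivAt.congr_deriv (((d1.add d2).add d3).sub d4) ?_
    push_cast; ring
  · intro t x
    exact ((hasDerivAt_param (fun t x => h.sm.ux.hasDerivAt_x t x) c2 c5 t x).mul
      (h.sm.hasDerivAt_x t x)).neg
  · fun_prop
  · fun_prop
  · exact cFall
  · intro t ht
    simp [(h.zR ht).1, (h.zL ht).1]
  · fun_prop
  · intro t ht x
    have := h.intpde ht.1.le x
    linear_combination u t x * this

/-- properties of the multiplier -/
structure Mult (V φ p : ℝ → ℝ) (L B : ℝ) : Prop where
  d : ∀ x, HasDerivAt φ (p x) x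
  cp : Continuous p
  p0 : ∀ x, 0 ≤ p x
  p1 : ∀ x, p x ≤ 1
  pL : ∀ x, |x| ≤ L → 4/5 ≤ p x
  b : ∀ x, |φ x| ≤ B
  s : ∀ x, φ x * deriv V x ≤ 0

lemma Loc.mora (h : Loc V a u T R) {φ p : ℝ → ℝ} {L B : ℝ} (m : Mult V φ p L B)
    (hV : ContDiff ℝ 1 V) {H : ℝ → ℝ → ℝ}
    (cH : Continuous (fun p : ℝ × ℝ => H p.1 p.2))
    (hH : ∀ t ∈ Set.Ioo 0 T,
      ∫ x in (-R)..R, ((1/4 - 1/2 * p x) * (ut u t x)^2 + (-1/4 - 1/2 * p x) * (ux u t x)^2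
        + (1/2 * p x - 1/4) * V x * (u t x)^2 + 1/2 * (φ x * deriv V x) * (u t x)^2
        - a x * φ x * ut u t x * ux u t x) ≤ ∫ x in (-R)..R, H t x) :
    (∫ x in (-R)..R, (φ x * (ut u T x * ux u T x)
      + 1/4 * (ut u T x * u T x + 1/2 * a x * (u T x)^2)))
      - (∫ x in (-R)..R, (φ x * (ut u 0 x * ux u 0 x)
      + 1/4 * (ut u 0 x * u 0 x + 1/2 * a x * (u 0 x)^2)))
      ≤ ∫ t in (0:ℝ)..T, ∫ x in (-R)..R, H t x := by
  have cV := h.cV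
  have ca := h.ca
  have cV' : Continuous (deriv V) := hV.continuous_deriv le_rfl
  have cφ : Continuous φ := continuous_iff_continuousAt.2 fun x => (m.d x).continuousAt
  have cp := m.cp
  have c0 := h.sm.continuous
  have c1 := h.sm.ut.continuous
  have c2 := h.sm.ux.continuous
  have c3 := h.sm.ut.ut.continuous
  have c4 := h.sm.ut.ux.continuous
  have c5 := h.sm.ux.ux.continuous
  refine div_le (F := fun t x => φ x * (ut u t x * ux u t x)
      + 1/4 * (ut u t x * u t x + 1/2 * a x * (u t x)^2))
    (Ft := fun t x => φ x * (ut (ut u) t x * ux u t x + ut u t x * ux (ut u) t x)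
      + 1/4 * (ut (ut u) t x * u t x + ut u t x * ut u t x + 1/2 * a x * (2 * u t x * ut u t x)))
    (G := fun t x => -(1/2 * (φ x * ((ut u t x)^2 + (ux u t x)^2 - V x * (u t x)^2))
      + 1/4 * (ux u t x * u t x)))
    (Gx := fun t x => -(1/2 * (p x * ((ut u t x)^2 + (ux u t x)^2 - V x * (u t x)^2)
        + φ x * (2 * ut u t x * ux (ut u) t x + 2 * ux u t x * ux (ux u) t x
          - (deriv V x * (u t x)^2 + V x * (2 * u t x * ux u t x))))
      + 1/4 * (ux (ux u) t x * u t x + ux u t x * ux u t x)))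
    h.hT ?_ ?_ ?_ ?_ ?_ ?_ cH ?_
  · intro t x
    have d1 := ((h.sm.ut.hasDerivAt_t t x).mul (h.sm.ux.hasDerivAt_t t x)).const_mul (φ x)
    rw [h.sm.comm] at d1
    have d2 := (h.sm.ut.hasDerivAt_t t x).mul (h.sm.hasDerivAt_t t x)
    have d3 := ((h.sm.hasDerivAt_t t x).pow 2).const_mul (1/2 * a x)
    refine HasDerivAt.congr_deriv (d1.add ((d2.add d3).const_mul (1/4))) ?_
    push_cast; ring
  · intro t x
    have dV : HasDerivAt V (deriv V x) x := (hV.differentiable (by simp) x).hasDerivAt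
    have d1 := ((h.sm.ut.hasDerivAt_x t x).pow 2).add ((h.sm.ux.hasDerivAt_x t x).pow 2)
    have d2 := dV.mul ((h.sm.hasDerivAt_x t x).pow 2)
    have d3 := (h.sm.ux.hasDerivAt_x t x).mul (h.sm.hasDerivAt_x t x)
    refine HasDerivAt.congr_deriv (((((m.d x).mul (d1.sub d2)).const_mul (1/2)).add (d3.const_mul (1/4))).neg) ?_
    simp
  · fun_prop
  · fun_prop
  · intro t
    have := cont_slice_x c0 t
    have := cont_slice_x c1 t
    have := cont_slice_x c2 t
    fun_prop
  · intro t ht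
    simp [h.zR ht, h.zL ht]
  · intro t ht
    refine le_trans (le_of_eq ?_) (hH t ht)
    apply intervalIntegral.integral_congr
    intro x _
    have := h.pde t ht.1 x
    dsimp only
    linear_combination (φ x * ux u t x + 1/4 * u t x) * this

end

lemma pt_est {A X U v av p φ V' M B ε V0 i : ℝ} (hε : 0 < ε)
    (hv : 0 ≤ v) (hvV : v ≤ V0) (ha : 0 ≤ av) (haM : av ≤ M)
    (p0 : 0 ≤ p) (p1 : p ≤ 1) (hφ : |φ| ≤ B) (hs : φ * V' ≤ 0)
    (hc : (i = 1 ∧ 4/5 ≤ p) ∨ (i = 0 ∧ ε ≤ av)) :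
    (1/4 - 1/2 * p) * A^2 + (-1/4 - 1/2 * p) * X^2
        + (1/2 * p - 1/4) * v * U^2 + 1/2 * (φ * V') * U^2
        - av * φ * A * X ≤
    -(3/20) * A^2 - (3/16) * X^2 - (1/4) * (v * U^2) + (2/(5*ε) + 4*M*B^2) * (av * A^2)
      + (1/2 * V0 / ε) * (av * U^2) + 1/2 * V0 * (i * U^2) := by
  have hA := sq_nonneg A
  have hX := sq_nonneg X
  have hU := sq_nonneg U
  have hV0 : 0 ≤ V0 := hv.trans hvV
  have hM : 0 ≤ M := ha.trans haM
  have h1 : - av * φ * A * X ≤ 1/16 * X^2 + 4*M*B^2 * (av * A^2) := by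
    have e1 : - av * φ * A * X ≤ 1/16 * X^2 + 4 * (av^2 * φ^2 * A^2) := by
      nlinarith [sq_nonneg (1/4 * X + 2 * (av * φ * A))]
    have e2 : av^2 * φ^2 * A^2 ≤ (M * av) * B^2 * A^2 := by
      have : φ^2 ≤ B^2 := sq_le_sq' (by linarith [(abs_le.1 hφ).1]) (abs_le.1 hφ).2
      have : av^2 ≤ M * av := by nlinarith
      gcongr
    nlinarith
  have h2 : 1/2 * (φ * V') * U^2 ≤ 0 := by
    have := mul_nonneg (neg_nonneg.2 hs) hU
    linarith
  have h3 : (-1/4 - 1/2 * p) * X^2 ≤ -(1/4) * X^2 := by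
    have := mul_nonneg p0 hX
    linarith
  have hd : 2/(5*ε) = 2/5 * (1/ε) := by field_simp
  have hd2 : 1/2 * V0 / ε = 1/2 * V0 * (1/ε) := by field_simp
  have h4 : (1/4 - 1/2 * p) * A^2 ≤ -(3/20) * A^2 + 2/(5*ε) * (av * A^2) := by
    rcases hc with ⟨_, hp⟩ | ⟨_, hp⟩
    · have : 0 ≤ 2/(5*ε) * (av * A^2) := by positivity
      nlinarith
    · have e : 1 ≤ 1/ε * av := by
        rw [one_div_mul_eq_div, le_div_iff₀ hε]; linarith
      rw [hd]
      have := mul_nonneg p0 hA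
      have := mul_le_mul_of_nonneg_right e hA
      linarith
  have h5 : (1/2 * p - 1/4) * v * U^2 ≤ -(1/4) * (v * U^2) + (1/2 * V0 / ε) * (av * U^2)
      + 1/2 * V0 * (i * U^2) := by
    have q : (1/2 * p - 1/4) * v * U^2 ≤ -(1/4) * (v * U^2) + 1/2 * V0 * U^2 := by
      have e1 : p * (v * U^2) ≤ 1 * (v * U^2) := by gcongr
      have e2 : v * U^2 ≤ V0 * U^2 := by gcongr
      linarith
    rcases hc with ⟨hi, hp⟩ | ⟨hi, hp⟩
    · have : 0 ≤ (1/2 * V0 / ε) * (av * U^2) := by positivity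
      rw [hi]; linarith
    · have e : 1 ≤ 1/ε * av := by
        rw [one_div_mul_eq_div, le_div_iff₀ hε]; linarith
      rw [hd2, hi]
      have := mul_le_mul_of_nonneg_left e (by positivity : 0 ≤ 1/2 * V0 * U^2)
      linarith
  linarith

lemma slice_est {a V φ p : ℝ → ℝ} {L ε C V0 M B R : ℝ} {A X U : ℝ → ℝ} (hε : 0 < ε) (hC : 0 < C)
    (m : Mult V φ p L B) (ca : Continuous a) (hV : ContDiff ℝ 1 V)
    (ha : ∀ x, 0 ≤ a x) (haM : ∀ x, a x ≤ M)
    (ha_eff : ∀ x : ℝ, L ≤ |x| → ε ≤ a x)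
    (hVp : ∀ x, 0 < V x) (hVV : ∀ x, V x ≤ V0) (hV0 : V0 < 1 / (4 * C))
    (hP : ∀ w : ℝ → ℝ, ContDiff ℝ 1 w →
      Integrable (fun x => w x ^ 2) → Integrable (fun x => deriv w x ^ 2) →
      ∫ x in {x : ℝ | |x| ≤ L}, w x ^ 2 ≤
        C * ((∫ x, deriv w x ^ 2) + ∫ x in {x : ℝ | L ≤ |x|}, w x ^ 2))
    (cA : Continuous A) (cX : Continuous X) (cU : Continuous U)
    (hUX : ∀ x, HasDerivAt U (X x) x)
    (z : ∀ x, R ≤ |x| → U x = 0 ∧ A x = 0 ∧ X x = 0) :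
    ∫ x in (-R)..R, ((1/4 - 1/2 * p x) * (A x)^2 + (-1/4 - 1/2 * p x) * (X x)^2
        + (1/2 * p x - 1/4) * V x * (U x)^2 + 1/2 * (φ x * deriv V x) * (U x)^2
        - a x * φ x * A x * X x) ≤
    ∫ x in (-R)..R, (-(1/16) * ((A x)^2 + (X x)^2 + V x * (U x)^2)
      + (2/(5*ε) + 4*M*B^2) * (a x * (A x)^2)
      + (1/2 * V0 / ε + 1/(8*ε)) * (a x * (U x)^2)) := by
  have cV := hV.continuous
  have cV' : Continuous (deriv V) := hV.continuous_deriv le_rfl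
  have cφ : Continuous φ := continuous_iff_continuousAt.2 fun x => (m.d x).continuousAt
  have cp := m.cp
  have hV0p : 0 < V0 := (hVp 0).trans_le (hVV 0)
  have dU : deriv U = X := funext fun x => (hUX x).deriv
  have iU : Integrable (fun x => (U x)^2) :=
    integrable_of_vanish (R := R) (by fun_prop) (fun x hx => by simp [z x hx])
  have iX : Integrable (fun x => (X x)^2) :=
    integrable_of_vanish (R := R) (by fun_prop) (fun x hx => by simp [z x hx])
  have iaU : Integrable (fun x => a x * (U x)^2) :=
    integrable_of_vanish (R := R) (by fun_prop) (fun x hx => by simp [z x hx])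
  have hPU := hP U (contDiff_one_iff_deriv.2 ⟨fun x => (hUX x).differentiableAt, by rwa [dU]⟩) iU
    (by rw [dU]; exact iX)
  rw [dU] at hPU
  have mIn : MeasurableSet {x : ℝ | |x| ≤ L} := measurableSet_le (by fun_prop) (by fun_prop)
  have mOut : MeasurableSet {x : ℝ | L ≤ |x|} := measurableSet_le (by fun_prop) (by fun_prop)
  have hout : ∫ x in {x : ℝ | L ≤ |x|}, (U x)^2 ≤ (1/ε) * ∫ x, a x * (U x)^2 := by
    rw [← integral_const_mul, ← integral_indicator mOut]
    refine integral_mono (iU.indicator mOut) (iaU.const_mul _) fun x => ?_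
    dsimp only
    by_cases hx : x ∈ {x : ℝ | L ≤ |x|}
    · rw [Set.indicator_of_mem hx]
      have e : 1 ≤ 1/ε * a x := by
        rw [one_div_mul_eq_div, le_div_iff₀ hε]; linarith [ha_eff x hx]
      nlinarith [sq_nonneg (U x)]
    · rw [Set.indicator_of_notMem hx]
      have := ha x
      positivity
  have hVC : V0 * C ≤ 1/4 := by
    rw [lt_div_iff₀ (by positivity)] at hV0
    linarith
  have hin : 1/2 * V0 * ∫ x in {x : ℝ | |x| ≤ L}, (U x)^2 ≤
      1/8 * (∫ x, (X x)^2) + 1/(8*ε) * ∫ x, a x * (U x)^2 := by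
    have n1 : 0 ≤ ∫ x, (X x)^2 := integral_nonneg fun x => sq_nonneg _
    have n2 : 0 ≤ (1/ε) * ∫ x, a x * (U x)^2 :=
      mul_nonneg (by positivity) (integral_nonneg fun x => mul_nonneg (ha x) (sq_nonneg _))
    have e : 1/(8*ε) = 1/8 * (1/ε) := by field_simp
    calc 1/2 * V0 * ∫ x in {x : ℝ | |x| ≤ L}, (U x)^2 
        ≤ 1/2 * V0 * (C * ((∫ x, (X x)^2) + (1/ε) * ∫ x, a x * (U x)^2)) := by
          gcongr
          refine hPU.trans ?_
          gcongr
      _ = 1/2 * (V0 * C) * ((∫ x, (X x)^2) + (1/ε) * ∫ x, a x * (U x)^2) := by ring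
      _ ≤ 1/2 * (1/4) * ((∫ x, (X x)^2) + (1/ε) * ∫ x, a x * (U x)^2) := by
          gcongr
      _ = _ := by rw [e]; ring
  rw [← int_conv (R := R) (fun x hx => by simp [z x hx]),
    ← int_conv (R := R) (fun x hx => by simp [z x hx])]
  have iQ : Integrable (fun x => (1/4 - 1/2 * p x) * (A x)^2 + (-1/4 - 1/2 * p x) * (X x)^2
        + (1/2 * p x - 1/4) * V x * (U x)^2 + 1/2 * (φ x * deriv V x) * (U x)^2
        - a x * φ x * A x * X x) :=
    integrable_of_vanish (R := R) (by fun_prop) (fun x hx => by simp [z x hx])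
  have iP : Integrable (fun x => -(3/20) * (A x)^2 - (3/16) * (X x)^2 - (1/4) * (V x * (U x)^2)
      + (2/(5*ε) + 4*M*B^2) * (a x * (A x)^2) + (1/2 * V0 / ε) * (a x * (U x)^2)) :=
    integrable_of_vanish (R := R) (by fun_prop) (fun x hx => by simp [z x hx])
  have iI : Integrable (fun x => 1/2 * V0 * ({x : ℝ | |x| ≤ L}.indicator (fun x => (U x)^2) x)) :=
    (iU.indicator mIn).const_mul _
  have iH : Integrable (fun x => -(1/16) * ((A x)^2 + (X x)^2 + V x * (U x)^2)
      + (2/(5*ε) + 4*M*B^2) * (a x * (A x)^2)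
      + (1/2 * V0 / ε + 1/(8*ε)) * (a x * (U x)^2)) :=
    integrable_of_vanish (R := R) (by fun_prop) (fun x hx => by simp [z x hx])
  have s1 := integral_mono iQ (iP.add iI) (fun x => by
    by_cases hx : x ∈ {x : ℝ | |x| ≤ L}
    · have := pt_est (A := A x) (X := X x) (U := U x) (i := 1) hε (hVp x).le (hVV x) (ha x) (haM x)
        (m.p0 x) (m.p1 x) (m.b x) (m.s x) (Or.inl ⟨rfl, m.pL x hx⟩)
      simp only [Pi.add_apply, Set.indicator_of_mem hx]
      linarith
    · have := pt_est (A := A x) (X := X x) (U := U x) (i := 0) hε (hVp x).le (hVV x) (ha x) (haM x)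
        (m.p0 x) (m.p1 x) (m.b x) (m.s x)
        (Or.inr ⟨rfl, ha_eff x (le_of_lt (by simpa using hx))⟩)
      simp only [Pi.add_apply, Set.indicator_of_notMem hx]
      linarith)
  rw [integral_add' iP iI, integral_const_mul, integral_indicator mIn] at s1
  have s2 : (∫ x, (-(3/20) * (A x)^2 - (3/16) * (X x)^2 - (1/4) * (V x * (U x)^2)
      + (2/(5*ε) + 4*M*B^2) * (a x * (A x)^2) + (1/2 * V0 / ε) * (a x * (U x)^2)))
      + (1/8 * (∫ x, (X x)^2) + 1/(8*ε) * ∫ x, a x * (U x)^2) ≤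
      ∫ x, (-(1/16) * ((A x)^2 + (X x)^2 + V x * (U x)^2)
      + (2/(5*ε) + 4*M*B^2) * (a x * (A x)^2)
      + (1/2 * V0 / ε + 1/(8*ε)) * (a x * (U x)^2)) := by
    have iS : Integrable (fun x => 1/8 * (X x)^2 + 1/(8*ε) * (a x * (U x)^2)) :=
      (iX.const_mul _).add (iaU.const_mul _)
    rw [← integral_const_mul, ← integral_const_mul,
      ← integral_add (iX.const_mul _) (iaU.const_mul _),
      ← integral_add iP iS]
    refine integral_mono (iP.add iS) iH fun x => ?_
    have := mul_nonneg (hVp x).le (sq_nonneg (U x))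
    dsimp only
    nlinarith [sq_nonneg (A x)]
  linarith

lemma V_le {V : ℝ → ℝ} (hV : ContDiff ℝ 1 V) (hV2 : ∀ x, deriv V x * x ≤ 0) (x : ℝ) :
    V x ≤ V 0 := by
  have hd : Differentiable ℝ V := hV.differentiable (by simp)
  rcases le_total 0 x with hx | hx
  · have : AntitoneOn V (Set.Ici 0) := by
      refine antitoneOn_of_deriv_nonpos (convex_Ici 0) hd.continuous.continuousOn
        hd.differentiableOn fun y hy => ?_
      rw [interior_Ici] at hy
      have hy : 0 < y := hy
      have := hV2 y
      by_contra h
      exact absurd this (not_le.2 (mul_pos (not_le.1 h) hy))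
    exact this (Set.mem_Ici.2 le_rfl) hx hx
  · have : MonotoneOn V (Set.Iic 0) := by
      refine monotoneOn_of_deriv_nonneg (convex_Iic 0) hd.continuous.continuousOn
        hd.differentiableOn fun y hy => ?_
      rw [interior_Iic] at hy
      have hy : y < 0 := hy
      have := hV2 y
      by_contra h
      exact absurd this (not_le.2 (mul_pos_of_neg_of_neg (not_le.1 h) hy))
    exact this hx (Set.mem_Iic.2 le_rfl) hx

lemma exists_mult {V : ℝ → ℝ} {L : ℝ} (hL : 0 < L) (hV2 : ∀ x, deriv V x * x ≤ 0) :
    Mult V (fun x => 2 * L * Real.arctan (x / (2 * L))) (fun x => 1 / (1 + (x / (2 * L))^2)) L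
      (2 * L * 2) where
  d x := by
    have := (((hasDerivAt_id x).div_const (2 * L)).arctan).const_mul (2 * L)
    refine this.congr_deriv ?_
    simp only [id]
    field_simp
  cp := by
    refine continuous_const.div (by fun_prop) fun x => by positivity
  p0 x := by positivity
  p1 x := by
    rw [div_le_one (by positivity)]
    nlinarith [sq_nonneg (x / (2 * L))]
  pL x hx := by
    rw [le_div_iff₀ (by positivity)]
    have : (x / (2 * L))^2 ≤ 1/4 := by
      rw [div_pow, div_le_iff₀ (by positivity)]
      nlinarith [sq_le_sq' (abs_le.1 hx).1 (abs_le.1 hx).2]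
    linarith
  b x := by
    rw [abs_mul, abs_of_pos (by positivity : 0 < 2 * L)]
    have : |Real.arctan (x / (2 * L))| ≤ 2 := by
      rw [abs_le]
      constructor <;> linarith [Real.arctan_lt_pi_div_two (x / (2 * L)),
        Real.neg_pi_div_two_lt_arctan (x / (2 * L)), Real.pi_le_four]
    gcongr
  s x := by
    have h := hV2 x
    rcases lt_trichotomy x 0 with hx | hx | hx
    · have h1 : Real.arctan (x / (2 * L)) < 0 := by
        rw [Real.arctan_lt_zero]
        exact div_neg_of_neg_of_pos hx (by positivity)
      have h2 : 0 ≤ deriv V x := by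
        by_contra h'
        exact absurd h (not_le.2 (mul_pos_of_neg_of_neg (not_le.1 h') hx))
      exact mul_nonpos_of_nonpos_of_nonneg
        (mul_nonpos_of_nonneg_of_nonpos (by positivity) h1.le) h2
    · simp [hx]
    · have h1 : 0 < Real.arctan (x / (2 * L)) := by
        rw [Real.arctan_pos]
        positivity
      have h2 : deriv V x ≤ 0 := by
        by_contra h'
        exact absurd h (not_le.2 (mul_pos (not_le.1 h') hx))
      exact mul_nonpos_of_nonneg_of_nonpos (by positivity) h2

lemma exists_loc {V a : ℝ → ℝ} {u : ℝ → ℝ → ℝ} {u₀ u₁ : ℝ → ℝ} (h : IsSmoothSolution V a u u₀ u₁)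
    (cV : Continuous V) (ca : Continuous a) {T : ℝ} (hT : 0 ≤ T) : ∃ R, Loc V a u T R := by
  obtain ⟨hs, hpde, -, -, -, -, -, -, hz⟩ := h
  obtain ⟨R, hR, hz⟩ := hz (T + 1) (by linarith)
  have sm : Sm u := hs
  refine ⟨R + 1, hT, by linarith, hs, cV, ca, hpde, fun t ht x hx => ?_⟩
  have ht' : t ∈ Set.Icc 0 (T + 1) := ⟨ht.1, by linarith [ht.2]⟩
  refine ⟨hz t ht' x (by linarith), ?_, ?_⟩
  · have h1 := (sm.hasDerivAt_t t x).hasDerivWithinAt (s := Set.Icc 0 (T + 1))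
    have h2 : HasDerivWithinAt (fun s => u s x) 0 (Set.Icc 0 (T + 1)) t :=
      (hasDerivWithinAt_const t _ (0:ℝ)).congr (fun s hs => hz s hs x (by linarith))
        (hz t ht' x (by linarith))
    exact (uniqueDiffOn_Icc (by linarith : (0:ℝ) < T + 1) t ht').eq_deriv _ h1 h2
  · have : (fun y => u t y) =ᶠ[nhds x] fun _ => 0 := by
      have ho : {y : ℝ | R < |y|} ∈ nhds x :=
        (isOpen_lt continuous_const continuous_abs).mem_nhds (by
          show R < |x|
          linarith)
      filter_upwards [ho] with y hy
      exact hz t ht' y (le_of_lt hy)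
    unfold ux
    rw [this.deriv_eq]
    simp

lemma mult_bd {A X U φ av M B v : ℝ} (hφ : |φ| ≤ B) (ha : 0 ≤ av) (haM : av ≤ M) (hv : 0 ≤ v) :
    |φ * (A * X) + 1/4 * (A * U + 1/2 * av * U^2)| ≤ (B + 1 + M) * (A^2 + X^2 + v * U^2 + U^2) := by
  have hB : 0 ≤ B := (abs_nonneg _).trans hφ
  have hM : 0 ≤ M := ha.trans haM
  have h1 : |φ * (A * X)| ≤ B * (A^2 + X^2) := by
    rw [abs_mul]
    gcongr
    rw [abs_le]; constructor <;> nlinarith [sq_nonneg (A + X), sq_nonneg (A - X)]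
  have h2 : |1/4 * (A * U)| ≤ A^2 + U^2 := by
    rw [abs_le]; constructor <;> nlinarith [sq_nonneg (A + U), sq_nonneg (A - U)]
  have h3 : |1/4 * (1/2 * av * U^2)| ≤ M * U^2 := by
    rw [abs_of_nonneg (by positivity)]
    have : av * U^2 ≤ M * U^2 := by gcongr
    have : 0 ≤ av * U^2 := by positivity
    linarith
  have e : φ * (A * X) + 1/4 * (A * U + 1/2 * av * U^2)
      = φ * (A * X) + 1/4 * (A * U) + 1/4 * (1/2 * av * U^2) := by ring
  rw [e]
  refine (abs_add_three _ _ _).trans ?_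
  have : 0 ≤ v * U^2 := by positivity
  have : (B + 1 + M) * (A^2 + X^2 + v * U^2 + U^2) = B * (A^2 + X^2) + (A^2 + U^2) + M * U^2
    + (B + 1 + M) * (v * U^2) + B * U^2 + X^2 + M * (A^2 + X^2) := by ring
  have : 0 ≤ (B + 1 + M) * (v * U^2) + B * U^2 + X^2 + M * (A^2 + X^2) := by positivity
  linarith

lemma Loc.bdry {V a : ℝ → ℝ} {u : ℝ → ℝ → ℝ} {T R : ℝ} (h : Loc V a u T R) {φ : ℝ → ℝ}
    {M B : ℝ} (cφ : Continuous φ) (hφ : ∀ x, |φ x| ≤ B)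
    (ha : ∀ x, 0 ≤ a x) (haM : ∀ x, a x ≤ M) (hVp : ∀ x, 0 < V x) (t : ℝ) :
    |∫ x in (-R)..R, (φ x * (ut u t x * ux u t x)
      + 1/4 * (ut u t x * u t x + 1/2 * a x * (u t x)^2))| ≤
    (B + 1 + M) * ((∫ x in (-R)..R, ed V u t x) + ∫ x in (-R)..R, (u t x)^2) := by
  have cV := h.cV
  have ca := h.ca
  have c0 := cont_slice_x h.sm.continuous t
  have c1 := cont_slice_x h.sm.ut.continuous t
  have c2 := cont_slice_x h.sm.ux.continuous t
  have ce : Continuous (fun x => ed V u t x) := by unfold ed; fun_prop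
  rw [← intervalIntegral.integral_add (ce.intervalIntegrable _ _)
    (Continuous.intervalIntegrable (by fun_prop) _ _), ← intervalIntegral.integral_const_mul]
  have hR : -R ≤ R := by linarith [h.hR]
  refine (intervalIntegral.abs_integral_le_integral_abs hR).trans ?_
  refine intervalIntegral.integral_mono_on hR (Continuous.intervalIntegrable (by fun_prop) _ _)
    (Continuous.intervalIntegrable (by fun_prop) _ _) fun x _ => ?_
  exact mult_bd (hφ x) (ha x) (haM x) (hVp x).le

lemma Loc.Eu_eq {V a : ℝ → ℝ} {u : ℝ → ℝ → ℝ} {T R : ℝ} (h : Loc V a u T R) {t : ℝ}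
    (ht : t ∈ Set.Icc 0 T) : Eu V u t = 1/2 * ∫ x in (-R)..R, ed V u t x := by
  have cV := h.cV
  have c0 := cont_slice_x h.sm.continuous t
  have c1 := cont_slice_x h.sm.ut.continuous t
  have c2 := cont_slice_x h.sm.ux.continuous t
  have z := h.z t ht
  unfold Eu ed
  rw [int_conv (R := R) (f := fun x => (ut u t x)^2) (fun x hx => by simp [z x hx]),
    int_conv (R := R) (f := fun x => (ux u t x)^2) (fun x hx => by simp [z x hx]),
    int_conv (R := R) (f := fun x => V x * (u t x)^2) (fun x hx => by simp [z x hx]),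
    intervalIntegral.integral_add (Continuous.intervalIntegrable (by fun_prop) _ _)
    (Continuous.intervalIntegrable (by fun_prop) _ _),
    intervalIntegral.integral_add (Continuous.intervalIntegrable (by fun_prop) _ _)
    (Continuous.intervalIntegrable (by fun_prop) _ _)]

lemma arith {e0 eT n0 nT A1 A2 S mT m0 J D K1 K2 K3 V0 T : ℝ} (hK1 : 0 ≤ K1) (hK2 : 0 ≤ K2)
    (hK3 : 0 ≤ K3) (heT : 0 ≤ eT) (hnT : 0 ≤ nT) (hA1 : 0 ≤ A1)
    (hA2 : 0 ≤ A2) (hD : 0 ≤ D)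
    (h1 : eT - e0 ≤ -2 * A1) (h2 : 1/2 * nT - 1/2 * J - 1/2 * n0 ≤ - A2)
    (h3 : mT - m0 ≤ -(1/16) * S + K1 * A1 + K2 * A2)
    (b0 : |m0| ≤ K3 * (e0 + n0)) (bT : |mT| ≤ K3 * (eT + nT)) (h4 : T * eT ≤ S)
    (hD0 : e0 ≤ (1 + V0) * D) (hnJ : n0 + J ≤ D) (hn : n0 ≤ D) :
    1/2 * S ≤ (8 * (K1 * (1 + V0) + K2 + K3 * (2 * (1 + V0) + 2)) + (1 + V0)) * D ∧
    (1 + T) * (1/2 * eT) ≤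
      (8 * (K1 * (1 + V0) + K2 + K3 * (2 * (1 + V0) + 2)) + (1 + V0)) * D := by
  have i1 : K1 * A1 ≤ K1 * ((1 + V0) * D) := by gcongr; linarith
  have i2 : K2 * A2 ≤ K2 * D := by gcongr; linarith
  have i3 : K3 * (e0 + n0) ≤ K3 * ((1 + V0) * D + D) := by gcongr
  have i4 : K3 * (eT + nT) ≤ K3 * ((1 + V0) * D + D) := by gcongr <;> linarith
  have j0 := (abs_le.1 b0).2
  have jT := (abs_le.1 bT).1
  have hS : 1/16 * S ≤ (K1 * (1 + V0) + K2 + K3 * (2 * (1 + V0) + 2)) * D := by linarith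
  have : 0 ≤ e0 := by linarith
  constructor <;> linarith

lemma Loc.final {V a : ℝ → ℝ} {u : ℝ → ℝ → ℝ} {T R : ℝ} (h : Loc V a u T R)
    {φ p : ℝ → ℝ} {L ε C M B : ℝ} {u₀ u₁ : ℝ → ℝ} (hε : 0 < ε) (hC : 0 < C)
    (m : Mult V φ p L B) (hV : ContDiff ℝ 1 V)
    (ha : ∀ x, 0 ≤ a x) (haM : ∀ x, a x ≤ M)
    (ha_eff : ∀ x : ℝ, L ≤ |x| → ε ≤ a x)
    (hVp : ∀ x, 0 < V x) (hVV : ∀ x, V x ≤ V 0) (hV0 : V 0 < 1 / (4 * C))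
    (hP : ∀ w : ℝ → ℝ, ContDiff ℝ 1 w →
      Integrable (fun x => w x ^ 2) → Integrable (fun x => deriv w x ^ 2) →
      ∫ x in {x : ℝ | |x| ≤ L}, w x ^ 2 ≤
        C * ((∫ x, deriv w x ^ 2) + ∫ x in {x : ℝ | L ≤ |x|}, w x ^ 2))
    (i0 : ∀ x : ℝ, u 0 x = u₀ x) (i1 : ∀ x : ℝ, ut u 0 x = u₁ x) {K1 K2 K3 : ℝ}
    (hK1 : K1 = 2/(5*ε) + 4*M*B^2) (hK2 : K2 = 1/2 * V 0 / ε + 1/(8*ε)) (hK3 : K3 = B + 1 + M) :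
    (∫ s in Set.Icc (0:ℝ) T, Eu V u s) ≤
      (8 * (K1 * (1 + V 0) + K2 + K3 * (2 * (1 + V 0) + 2)) + (1 + V 0))
        * (((∫ x, u₀ x ^ 2) + ∫ x, (deriv u₀ x) ^ 2) + (∫ x, u₁ x ^ 2)
            + ∫ x, (u₁ x + a x * u₀ x) ^ 2 / V x) ∧
    (1 + T) * Eu V u T ≤
      (8 * (K1 * (1 + V 0) + K2 + K3 * (2 * (1 + V 0) + 2)) + (1 + V 0))
        * (((∫ x, u₀ x ^ 2) + ∫ x, (deriv u₀ x) ^ 2) + (∫ x, u₁ x ^ 2)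
            + ∫ x, (u₁ x + a x * u₀ x) ^ 2 / V x) := by
  have hT := h.hT
  have hR : -R ≤ R := by linarith [h.hR]
  have hM : 0 ≤ M := (ha 0).trans (haM 0)
  have hB : 0 ≤ B := (abs_nonneg _).trans (m.b 0)
  have hV0p := hVp 0
  have cV := h.cV
  have ca := h.ca
  have cφ : Continuous φ := continuous_iff_continuousAt.2 fun x => (m.d x).continuousAt
  have c0 := h.sm.continuous
  have c1 := h.sm.ut.continuous
  have c2 := h.sm.ux.continuous
  have s0 := fun t => cont_slice_x c0 t
  have s1 := fun t => cont_slice_x c1 t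
  have s2 := fun t => cont_slice_x c2 t
  have hne : ∀ x, V x ≠ 0 := fun x => (hVp x).ne'
  have eu0 : u₀ = fun x => u 0 x := funext fun x => (i0 x).symm
  have eu1 : u₁ = fun x => ut u 0 x := funext fun x => (i1 x).symm
  have edu : deriv u₀ = fun x => ux u 0 x := by rw [eu0]; rfl
  have z0 := h.z 0 ⟨le_rfl, hT⟩
  have ced : Continuous (fun q : ℝ × ℝ => ed V u q.1 q.2) := by unfold ed; fun_prop
  have cedx := fun t => cont_slice_x ced t
  have ca1 : Continuous (fun q : ℝ × ℝ => a q.2 * (ut u q.1 q.2)^2) := by fun_prop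
  have ca2 : Continuous (fun q : ℝ × ℝ => a q.2 * (u q.1 q.2)^2) := by fun_prop
  have cI := cont_int ced (-R) R
  have cI1 := cont_int (f := fun t x => a x * (ut u t x)^2) ca1 (-R) R
  have cI2 := cont_int (f := fun t x => a x * (u t x)^2) ca2 (-R) R
  have hED : (∫ s in Set.Icc (0:ℝ) T, Eu V u s)
      = 1/2 * ∫ t in (0:ℝ)..T, ∫ x in (-R)..R, ed V u t x := by
    rw [← intervalIntegral.integral_const_mul, intervalIntegral.integral_of_le hT,
      ← integral_Icc_eq_integral_Ioc]
    exact setIntegral_congr_fun measurableSet_Icc fun s hs => h.Eu_eq hs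
  rw [hED, h.Eu_eq ⟨hT, le_rfl⟩]
  have ne : ∀ t x, 0 ≤ ed V u t x := fun t x => by
    have := hVp x
    unfold ed; positivity
  have E1 := h.energy
  have E2 := h.l2 hVp
  have E4 := h.tenergy ha
  have E3 := h.mora m hV (H := fun t x => (-(1/16) * ed V u t x + K1 * (a x * (ut u t x)^2))
      + K2 * (a x * (u t x)^2)) (by fun_prop) (fun t ht => by
        rw [hK1, hK2]
        exact slice_est hε hC m ca hV ha haM ha_eff hVp hVV hV0 hP (s1 t) (s2 t) (s0 t)
          (fun x => h.sm.hasDerivAt_x t x) (h.z t ⟨ht.1.le, ht.2.le⟩))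
  have B0 := h.bdry cφ m.b ha haM hVp 0
  have BT := h.bdry cφ m.b ha haM hVp T
  rw [← hK3] at B0 BT
  -- simplify
  simp only [intervalIntegral.integral_const_mul, intervalIntegral.integral_neg] at E1 E2 E4
  rw [intervalIntegral.integral_sub (Continuous.intervalIntegrable (by fun_prop) _ _)
    (Continuous.intervalIntegrable (by fun_prop (disch := assumption)) _ _)] at E2
  simp only [intervalIntegral.integral_const_mul] at E2
  have split : ∫ t in (0:ℝ)..T, ∫ x in (-R)..R, ((-(1/16) * ed V u t x + K1 * (a x * (ut u t x)^2))
      + K2 * (a x * (u t x)^2)) = -(1/16) * (∫ t in (0:ℝ)..T, ∫ x in (-R)..R, ed V u t x)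
      + K1 * (∫ t in (0:ℝ)..T, ∫ x in (-R)..R, a x * (ut u t x)^2)
      + K2 * (∫ t in (0:ℝ)..T, ∫ x in (-R)..R, a x * (u t x)^2) := by
    simp only [← intervalIntegral.integral_const_mul (μ := volume) (a := 0) (b := T)]
    rw [← intervalIntegral.integral_add (Continuous.intervalIntegrable (by fun_prop) _ _)
      (Continuous.intervalIntegrable (by fun_prop) _ _),
      ← intervalIntegral.integral_add (Continuous.intervalIntegrable (by fun_prop) _ _)
      (Continuous.intervalIntegrable (by fun_prop) _ _)]
    apply intervalIntegral.integral_congr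
    intro t _
    have := s0 t
    have := s1 t
    have := cedx t
    dsimp only
    rw [intervalIntegral.integral_add (Continuous.intervalIntegrable (by fun_prop) _ _)
      (Continuous.intervalIntegrable (by fun_prop) _ _),
      intervalIntegral.integral_add (Continuous.intervalIntegrable (by fun_prop) _ _)
      (Continuous.intervalIntegrable (by fun_prop) _ _)]
    simp only [intervalIntegral.integral_const_mul]
  rw [split] at E3
  have n0 : ∫ x, u₀ x ^ 2 = ∫ x in (-R)..R, (u 0 x)^2 := by
    rw [eu0]; exact int_conv fun x hx => by simp [z0 x hx]
  have n1 : ∫ x, u₁ x ^ 2 = ∫ x in (-R)..R, (ut u 0 x)^2 := by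
    rw [eu1]; exact int_conv fun x hx => by simp [z0 x hx]
  have n2 : ∫ x, (deriv u₀ x) ^ 2 = ∫ x in (-R)..R, (ux u 0 x)^2 := by
    rw [edu]; exact int_conv fun x hx => by simp [z0 x hx]
  have nJ : ∫ x, (u₁ x + a x * u₀ x) ^ 2 / V x
      = ∫ x in (-R)..R, (ut u 0 x + a x * u 0 x) ^ 2 / V x := by
    rw [eu0, eu1]; exact int_conv fun x hx => by simp [z0 x hx]
  have p0 : 0 ≤ ∫ x in (-R)..R, (u 0 x)^2 :=
    intervalIntegral.integral_nonneg hR fun x _ => sq_nonneg _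
  have p1 : 0 ≤ ∫ x in (-R)..R, (ut u 0 x)^2 :=
    intervalIntegral.integral_nonneg hR fun x _ => sq_nonneg _
  have p2 : 0 ≤ ∫ x in (-R)..R, (ux u 0 x)^2 :=
    intervalIntegral.integral_nonneg hR fun x _ => sq_nonneg _
  have pJ : 0 ≤ ∫ x in (-R)..R, (ut u 0 x + a x * u 0 x) ^ 2 / V x :=
    intervalIntegral.integral_nonneg hR fun x _ => div_nonneg (sq_nonneg _) (hVp x).le
  have hE0 : ∫ x in (-R)..R, ed V u 0 x ≤ (∫ x in (-R)..R, (ut u 0 x)^2)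
      + (∫ x in (-R)..R, (ux u 0 x)^2) + V 0 * ∫ x in (-R)..R, (u 0 x)^2 := by
    have := s0 0
    have := s1 0
    have := s2 0
    have := cedx 0
    rw [← intervalIntegral.integral_const_mul,
      ← intervalIntegral.integral_add (Continuous.intervalIntegrable (by fun_prop) _ _)
      (Continuous.intervalIntegrable (by fun_prop) _ _),
      ← intervalIntegral.integral_add (Continuous.intervalIntegrable (by fun_prop) _ _)
      (Continuous.intervalIntegrable (by fun_prop) _ _)]
    refine intervalIntegral.integral_mono_on hR (Continuous.intervalIntegrable (by fun_prop) _ _)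
      (Continuous.intervalIntegrable (by fun_prop) _ _) fun x _ => ?_
    unfold ed
    have := hVV x
    gcongr
  rw [n0, n1, n2, nJ]
  refine arith (J := ∫ x in (-R)..R, (ut u 0 x + a x * u 0 x) ^ 2 / V x)
    (by rw [hK1]; positivity) (by rw [hK2]; positivity) (by rw [hK3]; positivity)
    (intervalIntegral.integral_nonneg hR fun x _ => ne T x)
    (intervalIntegral.integral_nonneg hR fun x _ => sq_nonneg (u T x))
    ?_ ?_ (by positivity) E1 E2 E3 B0 BT E4 ?_ ?_ ?_
  · exact intervalIntegral.integral_nonneg hT fun t _ =>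
      intervalIntegral.integral_nonneg hR fun x _ => mul_nonneg (ha x) (sq_nonneg _)
  · exact intervalIntegral.integral_nonneg hT fun t _ =>
      intervalIntegral.integral_nonneg hR fun x _ => mul_nonneg (ha x) (sq_nonneg _)
  · nlinarith [mul_nonneg hV0p.le p1, mul_nonneg hV0p.le p2, mul_nonneg hV0p.le pJ]
  · linarith
  · linarith

/-- **Proposition 2.1 (energy decay for smooth solutions).** Under (A.1), (A.2),
(V.1), (V.2), a Poincaré-type constant `C*`, and `0 < V(0) < 1/(4C*)`, there is a
constant `C > 0` such that every smooth classical solution with smooth compactly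
supported data satisfies, for all `t ≥ 0`:
`∫₀ᵗ E_u(s) ds ≤ C(‖u₀‖²_{H¹} + ‖u₁‖² + ∫ (u₁ + a u₀)²/V dx)` and
`(1+t) E_u(t) ≤ C(‖u₀‖²_{H¹} + ‖u₁‖² + ∫ (u₁ + a u₀)²/V dx)`. -/
theorem proposition_2_1
    (a V : ℝ → ℝ) (L ε₁ Cstar : ℝ)
    (hL : 0 < L) (hε₁ : 0 < ε₁) (hCstar : 0 < Cstar)
    (ha_cont : Continuous a) (ha_bdd : ∃ M, ∀ x, |a x| ≤ M) (ha_nonneg : ∀ x, 0 ≤ a x)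
    (ha_eff : ∀ x : ℝ, L ≤ |x| → ε₁ ≤ a x)
    (hV : ContDiff ℝ 1 V) (hV_bdd : ∃ M, ∀ x, |V x| ≤ M)
    (hV'_bdd : ∃ M, ∀ x, |deriv V x| ≤ M) (hV_pos : ∀ x, 0 < V x)
    (hV2 : ∀ x, deriv V x * x ≤ 0)
    (hP : ∀ w : ℝ → ℝ, ContDiff ℝ 1 w →
      Integrable (fun x => w x ^ 2) → Integrable (fun x => deriv w x ^ 2) →
      ∫ x in {x : ℝ | |x| ≤ L}, w x ^ 2 ≤
        Cstar * ((∫ x, deriv w x ^ 2) + ∫ x in {x : ℝ | L ≤ |x|}, w x ^ 2))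
    (hV0 : V 0 < 1 / (4 * Cstar)) :
    ∃ C > (0:ℝ), ∀ (u : ℝ → ℝ → ℝ) (u₀ u₁ : ℝ → ℝ),
      IsSmoothSolution V a u u₀ u₁ →
      ∀ t ≥ (0:ℝ),
        (∫ s in Set.Icc (0:ℝ) t, Eu V u s) ≤
          C * (((∫ x, u₀ x ^ 2) + ∫ x, (deriv u₀ x) ^ 2) + (∫ x, u₁ x ^ 2)
            + ∫ x, (u₁ x + a x * u₀ x) ^ 2 / V x) ∧
        (1 + t) * Eu V u t ≤
          C * (((∫ x, u₀ x ^ 2) + ∫ x, (deriv u₀ x) ^ 2) + (∫ x, u₁ x ^ 2)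
            + ∫ x, (u₁ x + a x * u₀ x) ^ 2 / V x) := by
  obtain ⟨M, hM⟩ := ha_bdd
  have haM : ∀ x, a x ≤ M := fun x => (le_abs_self _).trans (hM x)
  have hM0 : 0 ≤ M := (ha_nonneg 0).trans (haM 0)
  have hV0p := hV_pos 0
  refine ⟨8 * ((2/(5*ε₁) + 4*M*(2 * L * 2)^2) * (1 + V 0) + (1/2 * V 0 / ε₁ + 1/(8*ε₁))
    + (2 * L * 2 + 1 + M) * (2 * (1 + V 0) + 2)) + (1 + V 0), by positivity, ?_⟩
  intro u u₀ u₁ hu t ht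
  obtain ⟨R, hR⟩ := exists_loc hu hV.continuous ha_cont ht
  exact hR.final hε₁ hCstar (exists_mult hL hV2) hV ha_nonneg haM ha_eff hV_pos (V_le hV hV2)
    hV0 hP hu.2.2.1 hu.2.2.2.1 rfl rfl rfl
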